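/- arXiv:2105.10299 — 2 statements merged into one kernel-verified Lean document; each statement's English description precedes it below -/
import Mathlib

section
/- Fix an n×n real matrix A, an m×n real matrix C, an m×m real symmetric positive semidefinite matrix V, and an n×n real symmetric positive semidefinite matrix W, and define T(X, Y) = (A − AXC) Y (A − AXC)ᵀ + A X V Xᵀ Aᵀ + W for n×m matrices X and n×n symmetric positive semidefinite Y. Let Λ₀₀, Λ₀₁, Λ₁₀, Λ₁₁ be sets of n×m real matrices, and for each γ ∈ {00, 01, 10, 11} let Δγ be a function assigning to each symmetric positive semidefinite Y a matrix Δγ(Y) ∈ Λγ such that T(Δγ(Y), Y) ⪯ T(X, Y) for all X ∈ Λγ (Loewner-minimality of the gain). For λ₁, λ₂ ∈ [0,1] define g(Y) = λ₁λ₂ T(Δ₀₀(Y), Y) + λ₁(1−λ₂) T(Δ₀₁(Y), Y) + (1−λ₁)λ₂ T(Δ₁₀(Y), Y) + (1−λ₁)(1−λ₂) T(Δ₁₁(Y), Y). Then g is matrix-concave on the positive semidefinite cone: for all symmetric positive semidefinite Y₁, Y₂ and all α ∈ [0,1], α g(Y₁) + (1−α) g(Y₂) ⪯ g(α Y₁ +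 (1−α) Y₂). -/
open Matrix

/-- Proposition 1 of the paper: the one-step expected error-covariance
map `g(Y) = λ₁λ₂ T(Δ₀₀(Y), Y) + λ₁(1−λ₂) T(Δ₀₁(Y), Y) + (1−λ₁)λ₂ T(Δ₁₀(Y), Y)
+ (1−λ₁)(1−λ₂) T(Δ₁₁(Y), Y)`, where each `Δγ(Y)` achieves the Loewner minimum of
`T(·, Y)` over its gain class `Λγ`, is matrix-concave on the positive semidefinite cone. -/
theorem expected_covariance_map_concave {n m : Type*} [Fintype n] [Fintype m]
    (A : Matrix n n ℝ) (C : Matrix m n ℝ) (V : Matrix m m ℝ) (W : Matrix n n ℝ)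
    (hV : V.PosSemidef) (hW : W.PosSemidef)
    (T : Matrix n m ℝ → Matrix n n ℝ → Matrix n n ℝ)
    (hT : ∀ X Y, T X Y = (A - A * X * C) * Y * (A - A * X * C)ᵀ + A * X * V * Xᵀ * Aᵀ + W)
    (Λ00 Λ01 Λ10 Λ11 : Set (Matrix n m ℝ))
    (Δ00 Δ01 Δ10 Δ11 : Matrix n n ℝ → Matrix n m ℝ)
    (hΔ00 : ∀ Y, Y.PosSemidef → Δ00 Y ∈ Λ00 ∧ ∀ X ∈ Λ00, (T X Y - T (Δ00 Y) Y).PosSemidef)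
    (hΔ01 : ∀ Y, Y.PosSemidef → Δ01 Y ∈ Λ01 ∧ ∀ X ∈ Λ01, (T X Y - T (Δ01 Y) Y).PosSemidef)
    (hΔ10 : ∀ Y, Y.PosSemidef → Δ10 Y ∈ Λ10 ∧ ∀ X ∈ Λ10, (T X Y - T (Δ10 Y) Y).PosSemidef)
    (hΔ11 : ∀ Y, Y.PosSemidef → Δ11 Y ∈ Λ11 ∧ ∀ X ∈ Λ11, (T X Y - T (Δ11 Y) Y).PosSemidef)
    (lam1 lam2 : ℝ) (hlam1 : lam1 ∈ Set.Icc (0 : ℝ) 1) (hlam2 : lam2 ∈ Set.Icc (0 : ℝ) 1)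
    (g : Matrix n n ℝ → Matrix n n ℝ)
    (hg : ∀ Y, g Y = (lam1 * lam2) • T (Δ00 Y) Y + (lam1 * (1 - lam2)) • T (Δ01 Y) Y +
        ((1 - lam1) * lam2) • T (Δ10 Y) Y + ((1 - lam1) * (1 - lam2)) • T (Δ11 Y) Y) :
    ∀ Y1 Y2 : Matrix n n ℝ, Y1.PosSemidef → Y2.PosSemidef →
      ∀ α : ℝ, 0 ≤ α → α ≤ 1 →
        (g (α • Y1 + (1 - α) • Y2) - (α • g Y1 + (1 - α) • g Y2)).PosSemidef := by
  intro Y1 Y2 h1 h2 α h0 h1'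
  have hβ : 0 ≤ 1 - α := by linarith
  have hY : (α • Y1 + (1 - α) • Y2).PosSemidef := (h1.smul h0).add (h2.smul hβ)
  have aff : ∀ X, T X (α • Y1 + (1 - α) • Y2) = α • T X Y1 + (1 - α) • T X Y2 := by
    intro X
    simp only [hT, Matrix.mul_add, Matrix.add_mul, Matrix.mul_smul, Matrix.smul_mul]
    module
  have key : ∀ (L : Set (Matrix n m ℝ)) (D : Matrix n n ℝ → Matrix n m ℝ),
      (∀ Y, Y.PosSemidef → D Y ∈ L ∧ ∀ X ∈ L, (T X Y - T (D Y) Y).PosSemidef) →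
      (T (D (α • Y1 + (1 - α) • Y2)) (α • Y1 + (1 - α) • Y2)
        - (α • T (D Y1) Y1 + (1 - α) • T (D Y2) Y2)).PosSemidef := by
    intro L D hD
    have hm := (hD _ hY).1
    have e1 := ((hD Y1 h1).2 _ hm).smul h0
    have e2 := ((hD Y2 h2).2 _ hm).smul hβ
    have e := e1.add e2
    rw [aff]
    convert e using 1
    module
  obtain ⟨a0, a1⟩ := hlam1
  obtain ⟨b0, b1⟩ := hlam2
  have a2 : 0 ≤ 1 - lam1 := by linarith
  have b2 : 0 ≤ 1 - lam2 := by linarith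
  have e := ((((key _ _ hΔ00).smul (mul_nonneg a0 b0)).add
    ((key _ _ hΔ01).smul (mul_nonneg a0 b2))).add
    ((key _ _ hΔ10).smul (mul_nonneg a2 b0))).add
    ((key _ _ hΔ11).smul (mul_nonneg a2 b2))
  rw [hg, hg Y1, hg Y2]
  convert e using 1
  module
end

section
/- Fix an n×n real matrix A and an m×n real matrix C, reals c > 0 and α > 0 with cα > 1, and a set Λ of n×m real matrices such that (A − AXC)ᵀ(A − AXC) ⪰ α·I for every X ∈ Λ. Let (Z_t) be a sequence of n×n real symmetric positive semidefinite matrices with trace(Z₀) > 0 such that for every t there exists X_t ∈ Λ with Z_{t+1} ⪰ c (A − A X_t C) Z_t (A − A X_t C)ᵀ. Then trace(Z_t) ≥ (cα)ᵗ · trace(Z₀) for all t; in particular trace(Z_t) → ∞ as t → ∞. -/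
open Matrix

open scoped MatrixOrder Matrix.Norms.L2Operator in
theorem trace_mul_nonneg_aux {n : Type*} [Fintype n] [DecidableEq n]
    {M Z : Matrix n n ℝ} (hM : M.PosSemidef) (hZ : Z.PosSemidef) : 0 ≤ (M * Z).trace := by
  obtain ⟨B, rfl⟩ := CStarAlgebra.nonneg_iff_eq_star_mul_self.mp hZ.nonneg
  rw [Matrix.star_eq_conjTranspose]
  rw [← Matrix.mul_assoc, Matrix.trace_mul_comm, ← Matrix.mul_assoc]
  exact (hM.mul_mul_conjTranspose_same B).trace_nonneg

/-- divergence argument, Step 2 of the proof of Theorem 3: if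
`(A − AXC)ᵀ(A − AXC) ⪰ α·I` for every `X` in the gain class `Λ`, `cα > 1`,
`trace(Z₀) > 0`, and `Z_{t+1} ⪰ c (A − A X_t C) Z_t (A − A X_t C)ᵀ` for some `X_t ∈ Λ`
at every step, then `trace(Z_t) ≥ (cα)ᵗ trace(Z₀)`, and `trace(Z_t) → ∞`. -/
theorem trace_diverges_of_expanding_iteration {n m : Type*} [Fintype n] [Fintype m]
    [DecidableEq n]
    (A : Matrix n n ℝ) (C : Matrix m n ℝ) (c α : ℝ) (hc : 0 < c) (hα : 0 < α)
    (hcα : 1 < c * α)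
    (Λ : Set (Matrix n m ℝ))
    (hΛ : ∀ X ∈ Λ,
      ((A - A * X * C)ᵀ * (A - A * X * C) - α • (1 : Matrix n n ℝ)).PosSemidef)
    (Z : ℕ → Matrix n n ℝ) (hZpsd : ∀ t, (Z t).PosSemidef) (hZ0 : 0 < (Z 0).trace)
    (hstep : ∀ t, ∃ X ∈ Λ,
      (Z (t + 1) - c • ((A - A * X * C) * Z t * (A - A * X * C)ᵀ)).PosSemidef) :
    (∀ t, (c * α) ^ t * (Z 0).trace ≤ (Z t).trace) ∧
      Filter.Tendsto (fun t => (Z t).trace) Filter.atTop Filter.atTop := by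
  have key : ∀ t, (c * α) * (Z t).trace ≤ (Z (t + 1)).trace := by
    intro t
    obtain ⟨X, hX, h⟩ := hstep t
    have h1 := h.trace_nonneg
    have h2 := trace_mul_nonneg_aux (hΛ X hX) (hZpsd t)
    generalize A - A * X * C = F at h1 h2
    have h3 : (F * Z t * Fᵀ).trace = (Fᵀ * F * Z t).trace := by
      rw [Matrix.trace_mul_comm, Matrix.mul_assoc]
    rw [Matrix.trace_sub, Matrix.trace_smul, h3, smul_eq_mul] at h1
    rw [Matrix.sub_mul, Matrix.trace_sub, Matrix.smul_mul, Matrix.one_mul,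
      Matrix.trace_smul, smul_eq_mul] at h2
    have h4 := mul_nonneg hc.le h2
    linarith
  have main : ∀ t, (c * α) ^ t * (Z 0).trace ≤ (Z t).trace := by
    intro t
    induction t with
    | zero => simp
    | succ k ih =>
      have h := mul_le_mul_of_nonneg_left ih (mul_pos hc hα).le
      calc (c * α) ^ (k + 1) * (Z 0).trace = (c * α) * ((c * α) ^ k * (Z 0).trace) := by ring
        _ ≤ _ := h.trans (key k)
  exact ⟨main, Filter.tendsto_atTop_mono main
    ((tendsto_pow_atTop_atTop_of_one_lt hcα).atTop_mul_const hZ0)⟩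
end
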